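/- For every probability distribution Γ over [0,1]×{0,1}: ldCE(Γ) equals the infimum of dCE_D(f) over all pairs (D,f) in lift(Γ), and udCE(Γ) equals the supremum of dCE_D(f) over all pairs (D,f) in lift(Γ). Here lift(Γ) denotes the collection of pairs (D,f) where D is a probability distribution over 𝒳×{0,1} for some standard Borel measurable space 𝒳 and f:𝒳→[0,1] is a measurable predictor with D_f = Γ (this collection is nonempty, e.g. 𝒳=[0,1], D=Γ, f the identity). -/

import Mathlib

open MeasureTheory Set

noncomputable section

/-- The unit interval `[0,1]` as a type. -/
abbrev I01 : Type := unitInterval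

/-- The real value of a Boolean label. -/
def lbl (y : Bool) : ℝ := if y then 1 else 0

/-- The calibration correlation `E_{(v,y)∼Γ}[(y − v)·w(v)]` against a weight function `w`. -/
def calErr (Γ : Measure (I01 × Bool)) (w : I01 → ℝ) : ℝ :=
  ∫ p, (lbl p.2 - (p.1 : ℝ)) * w p.1 ∂Γ

/-- A prediction-label distribution `Γ` on `[0,1] × {0,1}` is perfectly calibrated iff
`E[(y − v)·w(v)] = 0` for every bounded measurable weight function `w`. -/
def PerfCal (Γ : Measure (I01 × Bool)) : Prop :=
  ∀ w : I01 → ℝ, Measurable w → (∃ C : ℝ, ∀ t, |w t| ≤ C) → calErr Γ w = 0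

/-- `ext(Γ)`: couplings `Π` of triples `(u,v,y)` whose `(v,y)`-marginal is `Γ` and whose
`(u,y)`-marginal is perfectly calibrated. -/
def extSet (Γ : Measure (I01 × Bool)) : Set (Measure (I01 × I01 × Bool)) :=
  {π | IsProbabilityMeasure π ∧
    π.map (fun p => (p.2.1, p.2.2)) = Γ ∧
    PerfCal (π.map (fun p => (p.1, p.2.2)))}

/-- The lower distance to calibration `ldCE(Γ)`. -/
def ldCE (Γ : Measure (I01 × Bool)) : ℝ :=
  sInf {x | ∃ π ∈ extSet Γ, x = ∫ p, |(p.1 : ℝ) - (p.2.1 : ℝ)| ∂π}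

/-- The upper distance to calibration `udCE(Γ)`: distance to calibration via post-processing. -/
def udCE (Γ : Measure (I01 × Bool)) : ℝ :=
  sInf {x | ∃ κ : I01 → I01, Measurable κ ∧
    PerfCal (Γ.map (fun p => (κ p.1, p.2))) ∧
    x = ∫ p, |(p.1 : ℝ) - (κ p.1 : ℝ)| ∂Γ}

/-- The smooth calibration error `smCE(Γ)`: supremum of `E[(y−v)w(v)]` over `1`-Lipschitz
weight functions `w : [0,1] → [−1,1]`. -/
def smCE (Γ : Measure (I01 × Bool)) : ℝ :=
  sSup {x | ∃ w : I01 → ℝ, LipschitzWith 1 w ∧ (∀ t, |w t| ≤ 1) ∧ x = calErr Γ w}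

/-- The prediction-label distribution `D_f` induced by a predictor `f`. -/
def predDist {𝒳 : Type*} [MeasurableSpace 𝒳] (D : Measure (𝒳 × Bool)) (f : 𝒳 → I01) :
    Measure (I01 × Bool) :=
  D.map (fun p => (f p.1, p.2))

/-- `cal(D)`: the set of measurable predictors that are perfectly calibrated w.r.t. `D`. -/
def calSet {𝒳 : Type*} [MeasurableSpace 𝒳] (D : Measure (𝒳 × Bool)) : Set (𝒳 → I01) :=
  {g | Measurable g ∧ PerfCal (predDist D g)}

/-- The true (ℓ₁) distance to calibration `dCE_D(f)`. -/
def dCE {𝒳 : Type*} [MeasurableSpace 𝒳] (D : Measure (𝒳 × Bool)) (f : 𝒳 → I01) : ℝ :=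
  sInf {x | ∃ g ∈ calSet D, x = ∫ p, |(f p.1 : ℝ) - (g p.1 : ℝ)| ∂D}

/-- A finite partition of `[0,1]` into (order-convex) intervals. -/
structure IntervalPartition where
  m : ℕ
  piece : Fin m → Set ℝ
  ordConn : ∀ j, (piece j).OrdConnected
  disj : ∀ i j, i ≠ j → Disjoint (piece i) (piece j)
  cover : (⋃ j, piece j) = Set.Icc (0 : ℝ) 1

/-- `binnedECE(Γ, 𝓘) = Σ_j |E[(v − y)·1(v ∈ I_j)]|`. -/
def binnedECE (Γ : Measure (I01 × Bool)) (P : IntervalPartition) : ℝ :=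
  ∑ j : Fin P.m,
    |∫ p, Set.indicator (P.piece j) (fun _ => ((p.1 : ℝ) - lbl p.2)) (p.1 : ℝ) ∂Γ|

/-- The average interval width `w_Γ(𝓘) = Σ_j E[1(v ∈ I_j)]·w(I_j)`. -/
def avgWidth (Γ : Measure (I01 × Bool)) (P : IntervalPartition) : ℝ :=
  ∑ j : Fin P.m,
    (∫ p, Set.indicator (P.piece j) (fun _ => (1 : ℝ)) (p.1 : ℝ) ∂Γ) * Metric.diam (P.piece j)

/-- The interval calibration error `intCE(Γ)`. -/
def intCE (Γ : Measure (I01 × Bool)) : ℝ :=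
  sInf {x | ∃ P : IntervalPartition, x = binnedECE Γ P + avgWidth Γ P}

/-- The random interval calibration error `RintCE(Γ, ε)`, with `r` uniform on `[0, ε)` and
intervals `I^ε_{r,j} = [r + jε, r + (j+1)ε)`. -/
def RintCE (Γ : Measure (I01 × Bool)) (ε : ℝ) : ℝ :=
  (1 / ε) * ∫ r in Set.Ico (0 : ℝ) ε,
    ∑' j : ℤ, |∫ p, Set.indicator (Set.Ico (r + (j : ℝ) * ε) (r + ((j : ℝ) + 1) * ε))
      (fun _ => (lbl p.2 - (p.1 : ℝ))) (p.1 : ℝ) ∂Γ|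

/-- The surrogate interval calibration error `SintCE(Γ)`. -/
def SintCE (Γ : Measure (I01 × Bool)) : ℝ :=
  ⨅ k : ℕ, (RintCE Γ ((1 / 2) ^ k) + (1 / 2) ^ k)

/-- The squared Laplace-kernel calibration error:
`K_Lap(Γ) = E[(y−v)(y′−v′)·exp(−|v−v′|)]` over two independent samples from `Γ`. -/
def KLap (Γ : Measure (I01 × Bool)) : ℝ :=
  ∫ q, (lbl q.1.2 - (q.1.1 : ℝ)) * (lbl q.2.2 - (q.2.1 : ℝ)) *
    Real.exp (-|(q.1.1 : ℝ) - (q.2.1 : ℝ)|) ∂(Γ.prod Γ)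

/-- The squared Gaussian-kernel calibration error:
`K_Gauss(Γ) = E[(y−v)(y′−v′)·exp(−(v−v′)²)]` over two independent samples from `Γ`. -/
def KGauss (Γ : Measure (I01 × Bool)) : ℝ :=
  ∫ q, (lbl q.1.2 - (q.1.1 : ℝ)) * (lbl q.2.2 - (q.2.1 : ℝ)) *
    Real.exp (-(((q.1.1 : ℝ) - (q.2.1 : ℝ)) ^ 2)) ∂(Γ.prod Γ)

/-- `lift(Γ)`: pairs `(D, f)` over some standard Borel measurable space `𝒳` with `D_f = Γ`. -/
structure Lift (Γ : Measure (I01 × Bool)) : Type 1 where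
  (𝒳 : Type)
  [inst : MeasurableSpace 𝒳]
  [sb : StandardBorelSpace 𝒳]
  (D : Measure (𝒳 × Bool))
  (f : 𝒳 → I01)
  (prob : IsProbabilityMeasure D)
  (meas : Measurable f)
  (eq : predDist D f = Γ)

theorem lbl_measurable : Measurable lbl := measurable_from_top

theorem abs_meas : Measurable fun q : I01 × I01 => |(q.1 : ℝ) - (q.2 : ℝ)| := by
  fun_prop

theorem dCE_bdd {𝒳 : Type*} [MeasurableSpace 𝒳] (D : Measure (𝒳 × Bool)) (f : 𝒳 → I01) :
    BddBelow {x | ∃ g ∈ calSet D, x = ∫ p, |(f p.1 : ℝ) - (g p.1 : ℝ)| ∂D} := by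
  refine ⟨0, ?_⟩
  rintro x ⟨g, -, rfl⟩
  exact integral_nonneg fun _ => abs_nonneg _

theorem ld_bdd (Γ : Measure (I01 × Bool)) :
    BddBelow {x | ∃ π ∈ extSet Γ, x = ∫ p, |(p.1 : ℝ) - (p.2.1 : ℝ)| ∂π} := by
  refine ⟨0, ?_⟩
  rintro x ⟨g, -, rfl⟩
  exact integral_nonneg fun _ => abs_nonneg _

theorem dCE_nonneg {𝒳 : Type*} [MeasurableSpace 𝒳] (D : Measure (𝒳 × Bool)) (f : 𝒳 → I01) :
    0 ≤ dCE D f := by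
  apply Real.sInf_nonneg
  rintro x ⟨g, -, rfl⟩
  exact integral_nonneg fun _ => abs_nonneg _

theorem exists_const_cal {𝒳 : Type*} [MeasurableSpace 𝒳] (D : Measure (𝒳 × Bool))
    [IsProbabilityMeasure D] : ∃ c : I01, (fun _ : 𝒳 => c) ∈ calSet D := by
  have hm : Measurable fun p : 𝒳 × Bool => lbl p.2 := lbl_measurable.comp measurable_snd
  have h0 : ∀ y, 0 ≤ lbl y := by intro y; cases y <;> simp [lbl]
  have h1 : ∀ y, lbl y ≤ 1 := by intro y; cases y <;> simp [lbl]
  have hi : Integrable (fun p : 𝒳 × Bool => lbl p.2) D := by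
    refine Integrable.of_bound hm.aestronglyMeasurable 1 (ae_of_all _ fun p => ?_)
    rw [Real.norm_eq_abs, abs_of_nonneg (h0 _)]
    exact h1 _
  have hc0 : 0 ≤ ∫ p, lbl p.2 ∂D := integral_nonneg fun _ => h0 _
  have hc1 : ∫ p, lbl p.2 ∂D ≤ 1 := by
    have := integral_mono hi (integrable_const (1 : ℝ)) (fun p => h1 p.2)
    simpa using this
  refine ⟨⟨∫ p, lbl p.2 ∂D, hc0, hc1⟩, measurable_const, ?_⟩
  intro w hw _
  unfold calErr predDist
  rw [integral_map (by fun_prop)]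
  · simp only
    rw [integral_mul_const, integral_sub hi (integrable_const _)]
    simp
  · apply Measurable.aestronglyMeasurable
    have := lbl_measurable
    fun_prop

theorem dCE_nonempty {𝒳 : Type*} [MeasurableSpace 𝒳] (D : Measure (𝒳 × Bool))
    [IsProbabilityMeasure D] (f : 𝒳 → I01) :
    {x | ∃ g ∈ calSet D, x = ∫ p, |(f p.1 : ℝ) - (g p.1 : ℝ)| ∂D}.Nonempty := by
  obtain ⟨c, hc⟩ := exists_const_cal D
  exact ⟨_, _, hc, rfl⟩

theorem udCE_eq (Γ : Measure (I01 × Bool)) : udCE Γ = dCE Γ id := by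
  unfold udCE dCE calSet predDist
  congr 1
  ext x
  constructor
  · rintro ⟨κ, h1, h2, h3⟩
    exact ⟨κ, ⟨h1, h2⟩, h3⟩
  · rintro ⟨κ, ⟨h1, h2⟩, h3⟩
    exact ⟨κ, h1, h2, h3⟩

theorem dCE_le_ud {𝒳 : Type*} [MeasurableSpace 𝒳] (D : Measure (𝒳 × Bool))
    (f : 𝒳 → I01) (hf : Measurable f) (Γ : Measure (I01 × Bool)) [IsProbabilityMeasure Γ]
    (h : predDist D f = Γ) : dCE D f ≤ udCE Γ := by
  rw [udCE_eq]
  refine le_csInf (dCE_nonempty Γ id) ?_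
  rintro x ⟨κ, ⟨hκ, hP⟩, rfl⟩
  refine csInf_le (dCE_bdd D f) ⟨κ ∘ f, ⟨hκ.comp hf, ?_⟩, ?_⟩
  · rw [← h] at hP
    unfold predDist at hP ⊢
    rw [Measure.map_map (by fun_prop) (by fun_prop)] at hP
    exact hP
  · rw [← h]
    unfold predDist
    rw [integral_map (by fun_prop)]
    · rfl
    · exact (abs_meas.comp (g := fun q : I01 × I01 => |(q.1 : ℝ) - (q.2 : ℝ)|)
        (f := fun p : I01 × Bool => (p.1, κ p.1)) (by fun_prop)).aestronglyMeasurable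

theorem mem_ext {𝒳 : Type*} [MeasurableSpace 𝒳] (D : Measure (𝒳 × Bool))
    [IsProbabilityMeasure D]
    (f g : 𝒳 → I01) (hf : Measurable f) (hg : g ∈ calSet D) (Γ : Measure (I01 × Bool))
    (h : predDist D f = Γ) :
    ∃ π ∈ extSet Γ, ∫ p, |(f p.1 : ℝ) - (g p.1 : ℝ)| ∂D
      = ∫ p, |(p.1 : ℝ) - (p.2.1 : ℝ)| ∂π := by
  obtain ⟨hg, hP⟩ := hg
  have hm : Measurable fun p : 𝒳 × Bool => (g p.1, f p.1, p.2) := by fun_prop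
  refine ⟨D.map fun p => (g p.1, f p.1, p.2), ⟨?_, ?_, ?_⟩, ?_⟩
  · exact Measure.isProbabilityMeasure_map hm.aemeasurable
  · rw [Measure.map_map (by fun_prop) hm]
    exact h
  · rw [Measure.map_map (by fun_prop) hm]
    exact hP
  · rw [integral_map hm.aemeasurable]
    · simp only [abs_sub_comm]
    · apply Measurable.aestronglyMeasurable
      fun_prop

theorem ld_le_dCE {𝒳 : Type*} [MeasurableSpace 𝒳] (D : Measure (𝒳 × Bool))
    [IsProbabilityMeasure D]
    (f : 𝒳 → I01) (hf : Measurable f) (Γ : Measure (I01 × Bool))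
    (h : predDist D f = Γ) : ldCE Γ ≤ dCE D f := by
  refine le_csInf (dCE_nonempty D f) ?_
  rintro x ⟨g, hg, rfl⟩
  obtain ⟨π, hπ, e⟩ := mem_ext D f g hf hg Γ h
  exact csInf_le (ld_bdd Γ) ⟨π, hπ, e⟩

theorem predDist_id (Γ : Measure (I01 × Bool)) : predDist Γ id = Γ := Measure.map_id

/-- The trivial lift. -/
def idLift (Γ : Measure (I01 × Bool)) [hΓ : IsProbabilityMeasure Γ] : Lift Γ :=
  { 𝒳 := I01, D := Γ, f := id, prob := hΓ, meas := measurable_id, eq := predDist_id Γ }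

/-- The lift coming from an extension. -/
def extLift (Γ : Measure (I01 × Bool)) (π : Measure (I01 × I01 × Bool)) (h : π ∈ extSet Γ) :
    Lift Γ :=
  { 𝒳 := I01 × I01
    D := π.map fun p => ((p.1, p.2.1), p.2.2)
    f := Prod.snd
    prob := by
      have := h.1
      exact Measure.isProbabilityMeasure_map (by fun_prop)
    meas := measurable_snd
    eq := by
      unfold predDist
      rw [Measure.map_map (by fun_prop) (by fun_prop)]
      exact h.2.1 }

theorem extLift_le (Γ : Measure (I01 × Bool)) (π : Measure (I01 × I01 × Bool))
    (h : π ∈ extSet Γ) :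
    dCE (π.map fun p => ((p.1, p.2.1), p.2.2)) (Prod.snd : I01 × I01 → I01)
      ≤ ∫ p, |(p.1 : ℝ) - (p.2.1 : ℝ)| ∂π := by
  refine csInf_le (dCE_bdd _ _) ⟨Prod.fst, ⟨measurable_fst, ?_⟩, ?_⟩
  · unfold predDist
    rw [Measure.map_map (by fun_prop) (by fun_prop)]
    exact h.2.2
  · rw [integral_map (by fun_prop)]
    · simp only [abs_sub_comm]
    · apply Measurable.aestronglyMeasurable
      fun_prop

/-- `ldCE(Γ)` is the infimum, and `udCE(Γ)` the supremum, of `dCE_D(f)`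
over all lifts `(D, f)` of `Γ` to a predictor over a standard Borel domain. -/
theorem ldCE_udCE_eq_inf_sup_dCE (Γ : Measure (I01 × Bool)) [IsProbabilityMeasure Γ] :
    ldCE Γ = sInf (Set.range fun ℓ : Lift Γ => letI := ℓ.inst; dCE ℓ.D ℓ.f) ∧
    udCE Γ = sSup (Set.range fun ℓ : Lift Γ => letI := ℓ.inst; dCE ℓ.D ℓ.f) := by
  have hne : (Set.range fun ℓ : Lift Γ => letI := ℓ.inst; dCE ℓ.D ℓ.f).Nonempty :=
    ⟨_, idLift Γ, rfl⟩
  constructor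
  · apply le_antisymm
    · refine le_csInf hne ?_
      rintro x ⟨ℓ, rfl⟩
      letI := ℓ.inst
      haveI := ℓ.prob
      exact ld_le_dCE ℓ.D ℓ.f ℓ.meas Γ ℓ.eq
    · refine le_csInf ?_ ?_
      · obtain ⟨c, hc⟩ := exists_const_cal Γ
        obtain ⟨π, hπ, -⟩ := mem_ext Γ id _ measurable_id hc Γ (predDist_id Γ)
        exact ⟨_, π, hπ, rfl⟩
      · rintro x ⟨π, hπ, rfl⟩
        refine le_trans (csInf_le ?_ ⟨extLift Γ π hπ, rfl⟩) (extLift_le Γ π hπ)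
        refine ⟨0, ?_⟩
        rintro x ⟨ℓ, rfl⟩
        letI := ℓ.inst
        exact dCE_nonneg ℓ.D ℓ.f
  · have hub : ∀ x ∈ (Set.range fun ℓ : Lift Γ => letI := ℓ.inst; dCE ℓ.D ℓ.f), x ≤ udCE Γ := by
      rintro x ⟨ℓ, rfl⟩
      letI := ℓ.inst
      exact dCE_le_ud ℓ.D ℓ.f ℓ.meas Γ ℓ.eq
    apply le_antisymm
    · exact le_csSup ⟨_, hub⟩ ⟨idLift Γ, (udCE_eq Γ).symm⟩
    · exact csSup_le hne hub
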